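/- Suppose ψ(3^n) ≤ 3^{-n} for all n ∈ ℕ. Let B be a ball in 𝔽₃((X⁻¹)) with radius r(B) = 3^{-ℓ} ≤ 1 and B ∩ 𝒞 ≠ ∅, and let n > ℓ. Then μ(B ∩ A*_n) = r(B)^γ · (ψ(3ⁿ) · 3ⁿ)^γ · 3^{-γ}. In particular, μ(A*_n) = (ψ(3ⁿ) · 3ⁿ)^γ · 3^{-γ} for all n ∈ ℕ. -/

import Mathlib

/-!
Setting: `𝔽₃((X⁻¹))`, the field of formal Laurent series over the field `𝔽₃` with `3` elements,
with absolute value `|f| = 3^N` when `f = ∑_{n ≥ -N} a_{-n} X^{-n}` with `a_N ≠ 0`, `|0| = 0`.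
We model it as `LaurentSeries (ZMod 3)` in the variable `t = X⁻¹`, so the coefficient
`a_{-n}` of `X^{-n}` is the coefficient of `t^n`, and `|f| = 3^{-ord_t f}`.
-/

noncomputable section
open scoped ENNReal Classical

instance : Fact (Nat.Prime 3) := ⟨by norm_num⟩

/-- The field with three elements. -/
abbrev F3 := ZMod 3

/-- The field `𝔽₃((X⁻¹))`, modelled as Laurent series in `t = X⁻¹`. -/
abbrev L3 := LaurentSeries F3

/-- The element `X`, i.e. `t⁻¹`. -/
def XL : L3 := HahnSeries.single (-1 : ℤ) 1

/-- The absolute value: `|f| = 3^{-ord_t f}` for `f ≠ 0` and `|0| = 0`. -/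
def absv (f : L3) : ℝ := if f = 0 then 0 else (3 : ℝ) ^ (-f.order)

/-- The ball of radius `r` around `x` for the ultrametric `d(x, y) = |x - y|`. -/
def ball (x : L3) (r : ℝ) : Set L3 := {y | absv (y - x) < r}

/-- The unit ball `𝕀 = {h : |h| < 1}` around `0`. -/
def unitBall : Set L3 := ball 0 1

/-- The Cantor set `𝒞`: elements of `𝕀` all of whose coefficients `a_{-n}` lie in `{0, 2}`. -/
def Cantor : Set L3 :=
  {f | (∀ m : ℤ, m ≤ 0 → f.coeff m = 0) ∧ ∀ m : ℤ, 1 ≤ m → f.coeff m = 0 ∨ f.coeff m = 2}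

/-- `γ = log 2 / log 3`. -/
def gam : ℝ := Real.log 2 / Real.log 3

/-- The Hausdorff `f`-measure of `A ⊆ 𝔽₃((X⁻¹))`, as defined in the paper:
`ℋ^f(A) = lim_{ρ → 0} inf ∑ᵢ f(r(Bᵢ))`, the infimum being over countable covers of `A`
by balls `Bᵢ` with radius `r(Bᵢ) ≤ ρ`.  Every ball has radius `3^k` for some `k ∈ ℤ`;
a ball is recorded as a pair (centre, k).  (The `⨆` over `ρ` is the limit `ρ → 0`, the inner
infimum being antitone in `ρ`.) -/
def hmeas (f : ℝ → ℝ) (A : Set L3) : ℝ≥0∞ :=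
  ⨆ (ρ : ℝ) (_ : 0 < ρ),
    ⨅ (S : Set (L3 × ℤ)) (_ : S.Countable)
      (_ : ∀ p ∈ S, (3 : ℝ) ^ p.2 ≤ ρ)
      (_ : A ⊆ ⋃ p ∈ S, ball p.1 ((3 : ℝ) ^ p.2)),
      ∑' p : S, ENNReal.ofReal (f ((3 : ℝ) ^ (p : L3 × ℤ).2))

/-- The Hausdorff `γ`-measure `ℋ^γ`. -/
def hgamma (A : Set L3) : ℝ≥0∞ := hmeas (fun r => r ^ gam) A

/-- `μ(A) = ℋ^γ(A ∩ 𝒞)`. -/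
def mu (A : Set L3) : ℝ≥0∞ := hgamma (A ∩ Cantor)

/-- A dimension function: a continuous, non-decreasing `f : ℝ_{≥0} → ℝ_{≥0}` with `f 0 = 0`. -/
structure IsDimFun (f : ℝ → ℝ) : Prop where
  mono : MonotoneOn f (Set.Ici 0)
  cont : ContinuousOn f (Set.Ici 0)
  zero : f 0 = 0
  nonneg : ∀ r, 0 ≤ r → 0 ≤ f r

/-- The image of a polynomial `g ∈ 𝔽₃[X]` in `𝔽₃((X⁻¹))`. -/
def toL (g : Polynomial F3) : L3 := Polynomial.aeval XL g

/-- `ℱ(N)`: polynomials over `𝔽₃` of degree `< N`, all of whose coefficients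
`a_0, …, a_{N-1}` lie in `{0, 2}`. -/
def Fset (N : ℕ) : Set (Polynomial F3) :=
  {g | g.degree < (N : ℕ) ∧ ∀ k < N, g.coeff k = 0 ∨ g.coeff k = 2}

/-- `ℱ*(N)`: members of `ℱ(N)` with `g(0) = 2`. -/
def FsetStar (N : ℕ) : Set (Polynomial F3) :=
  {g | g.degree < (N : ℕ) ∧ (∀ k < N, g.coeff k = 0 ∨ g.coeff k = 2) ∧ g.coeff 0 = 2}

/-- `W_𝒞(ψ)`: elements `h ∈ 𝒞` with `|h - g/X^N| < ψ(3^N)` for infinitely many `N ∈ ℕ`,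
where `g ∈ ℱ(N)`.  Here `ψ N` stands for `ψ(3^N)`. -/
def Wc (ψ : ℕ → ℝ) : Set L3 :=
  {h ∈ Cantor | ∀ m : ℕ, ∃ N : ℕ, m ≤ N ∧ 1 ≤ N ∧
    ∃ g ∈ Fset N, absv (h - toL g / XL ^ N) < ψ N}

/-- `W*_𝒞(ψ)`: defined like `W_𝒞(ψ)`, with `ℱ*(N)` in place of `ℱ(N)`. -/
def WcStar (ψ : ℕ → ℝ) : Set L3 :=
  {h ∈ Cantor | ∀ m : ℕ, ∃ N : ℕ, m ≤ N ∧ 1 ≤ N ∧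
    ∃ g ∈ FsetStar N, absv (h - toL g / XL ^ N) < ψ N}

/-- `A*_n = ⋃_{g ∈ ℱ*(n)} B(g/Xⁿ, ψ(3ⁿ))`. -/
def Astar (ψ : ℕ → ℝ) (n : ℕ) : Set L3 :=
  ⋃ g ∈ FsetStar n, ball (toL g / XL ^ n) (ψ n)

/-- `𝒦(ψ)`: elements `ξ ∈ 𝕀` with `|ξ - g/h| < ψ(|h|)` for infinitely many fractions
`g/h ∈ 𝔽₃(X)`.  Here `ψ d` stands for `ψ(3^d)`, and `|h| = 3^{deg h}`. -/
def Kset (ψ : ℕ → ℝ) : Set L3 :=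
  {ξ ∈ unitBall | {gh : Polynomial F3 × Polynomial F3 | gh.2 ≠ 0 ∧
    absv (ξ - toL gh.1 / toL gh.2) < ψ gh.2.natDegree}.Infinite}

/-- The irrationality exponent
`τ(ξ) = sup {τ : |ξ - g/h| < |h|^{-τ} for infinitely many g/h ∈ 𝔽₃(X)}`, valued in `[0, ∞]`. -/
def irrExp (ξ : L3) : ℝ≥0∞ :=
  sSup {t : ℝ≥0∞ | ∃ τ : ℝ, t = ENNReal.ofReal τ ∧
    {gh : Polynomial F3 × Polynomial F3 | gh.2 ≠ 0 ∧
      absv (ξ - toL gh.1 / toL gh.2) < absv (toL gh.2) ^ (-τ)}.Infinite}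

/-- The absolute value is below `3 ^ k` exactly when all coefficients up to `-k` vanish. -/
lemma absv_lt_zpow_iff (z : L3) (k : ℤ) :
    absv z < (3 : ℝ) ^ k ↔ ∀ m : ℤ, m ≤ -k → z.coeff m = 0 := by
  by_cases hz : z = 0
  · simp only [hz, absv, if_true, HahnSeries.coeff_zero, implies_true, iff_true]
    positivity
  · rw [absv, if_neg hz, zpow_lt_zpow_iff_right₀ (by norm_num)]
    constructor
    · intro h m hm
      exact HahnSeries.coeff_eq_zero_of_lt_order (by omega)
    · intro h
      by_contra! hk
      exact hz (HahnSeries.coeff_order_eq_zero.1 (h z.order (by omega)))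

lemma mem_ball_zpow_iff (x y : L3) (k : ℤ) :
    y ∈ ball x ((3 : ℝ) ^ k) ↔ ∀ m : ℤ, m ≤ -k → y.coeff m = x.coeff m := by
  simp only [ball, Set.mem_ofPred_eq, absv_lt_zpow_iff, HahnSeries.coeff_sub, sub_eq_zero]

/-- The element of the Cantor set whose coefficient of `X^{-(i+1)}` is `2` if `b i` holds and
`0` otherwise. -/
def cantorPoint (b : ℕ → Bool) : L3 :=
  HahnSeries.ofSuppBddBelow
    (fun m : ℤ => if 1 ≤ m then (if b (m - 1).toNat then (2 : F3) else 0) else 0)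
    ⟨1, fun m hm => by
      by_contra h
      exact hm (if_neg h)⟩

lemma coeff_cantorPoint (b : ℕ → Bool) (m : ℤ) :
    (cantorPoint b).coeff m = if 1 ≤ m then (if b (m - 1).toNat then (2 : F3) else 0) else 0 :=
  rfl

lemma coeff_cantorPoint_of_nonpos (b : ℕ → Bool) {m : ℤ} (hm : m ≤ 0) :
    (cantorPoint b).coeff m = 0 := by
  rw [coeff_cantorPoint, if_neg (by omega)]

lemma coeff_cantorPoint_succ (b : ℕ → Bool) (i : ℕ) :
    (cantorPoint b).coeff (i + 1 : ℤ) = if b i then (2 : F3) else 0 := by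
  rw [coeff_cantorPoint, if_pos (by omega)]
  simp

lemma two_ne_zero_F3 : (2 : F3) ≠ 0 := by decide

lemma range_cantorPoint : Set.range cantorPoint = Cantor := by
  ext f
  constructor
  · rintro ⟨b, rfl⟩
    refine ⟨fun m hm => coeff_cantorPoint_of_nonpos b hm, fun m hm => ?_⟩
    rw [coeff_cantorPoint, if_pos hm]
    split_ifs <;> simp
  · rintro ⟨h0, h1⟩
    refine ⟨fun i => decide (f.coeff (i + 1 : ℤ) = 2), ?_⟩
    ext m
    rw [coeff_cantorPoint]
    split_ifs with hm hb
    · rw [Int.toNat_of_nonneg (by omega)] at hb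
      simpa using (of_decide_eq_true hb).symm
    · rw [Int.toNat_of_nonneg (by omega)] at hb
      rcases h1 m hm with h | h
      · exact h.symm
      · simp [h] at hb
    · exact (h0 m (by omega)).symm

lemma cantorPoint_mem_ball_iff (b b' : ℕ → Bool) (n : ℕ) :
    cantorPoint b ∈ ball (cantorPoint b') ((3 : ℝ) ^ (-(n : ℤ))) ↔ ∀ i < n, b i = b' i := by
  rw [mem_ball_zpow_iff]
  constructor
  · intro h i hi
    have := h (i + 1) (by omega)
    rw [coeff_cantorPoint_succ, coeff_cantorPoint_succ] at this
    cases hb : b i <;> cases hb' : b' i <;>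
      simp [hb, hb', two_ne_zero_F3, two_ne_zero_F3.symm] at this ⊢
  · intro h m hm
    rw [coeff_cantorPoint, coeff_cantorPoint]
    split_ifs with h1 h2 h3 h3 <;> try rfl
    all_goals
      have := h (m - 1).toNat (by omega)
      simp_all

/-- The fair coin-tossing measure on `ℕ → Bool`. -/
def coinMeasure : MeasureTheory.Measure (ℕ → Bool) :=
  MeasureTheory.Measure.infinitePi fun _ => (PMF.uniformOfFintype Bool).toMeasure

instance : MeasureTheory.IsProbabilityMeasure coinMeasure := by
  unfold coinMeasure
  infer_instance

lemma coinMeasure_pi_singleton (s : Finset ℕ) (c : ℕ → Bool) :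
    coinMeasure (Set.pi s fun i => {c i}) = 2⁻¹ ^ s.card := by
  rw [coinMeasure, MeasureTheory.Measure.infinitePi_pi _ (fun i _ => MeasurableSet.singleton _)]
  simp

lemma zpow_rpow_gam (k : ℤ) : ((3 : ℝ) ^ k) ^ gam = (2 : ℝ) ^ k := by
  have h : (3 : ℝ) ^ gam = 2 := by
    rw [gam, Real.rpow_def_of_pos (by norm_num), mul_div_cancel₀ _ (by positivity),
      Real.exp_log (by norm_num)]
  rw [← Real.rpow_intCast, ← Real.rpow_mul (by norm_num), mul_comm, Real.rpow_mul (by norm_num), h,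
    Real.rpow_intCast]

lemma ofReal_two_zpow_neg (n : ℕ) : ENNReal.ofReal ((2 : ℝ) ^ (-(n : ℤ))) = 2⁻¹ ^ n := by
  rw [zpow_neg, zpow_natCast, ← inv_pow, ENNReal.ofReal_pow (by norm_num),
    ENNReal.ofReal_inv_of_pos (by norm_num)]
  simp

/-- Mass distribution bound: a ball carries at most its radius to the power `γ`. -/
lemma coinMeasure_preimage_ball_le (x : L3) (k : ℤ) :
    coinMeasure (cantorPoint ⁻¹' ball x ((3 : ℝ) ^ k)) ≤
      ENNReal.ofReal (((3 : ℝ) ^ k) ^ gam) := by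
  rw [zpow_rpow_gam]
  rcases le_or_gt 0 k with hk | hk
  · refine MeasureTheory.prob_le_one.trans ?_
    rw [← ENNReal.ofReal_one]
    exact ENNReal.ofReal_le_ofReal (one_le_zpow₀ (by norm_num) hk)
  · obtain ⟨n, rfl⟩ : ∃ n : ℕ, k = -(n : ℤ) := ⟨k.natAbs, by omega⟩
    rcases Set.eq_empty_or_nonempty (cantorPoint ⁻¹' ball x ((3 : ℝ) ^ (-(n : ℤ))))
      with h | ⟨b', hb'⟩
    · rw [h, MeasureTheory.measure_empty]
      exact zero_le
    · rw [ofReal_two_zpow_neg]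
      refine (MeasureTheory.measure_mono (t := Set.pi (Finset.range n) fun i => {b' i}) ?_).trans
        ?_
      · intro b hb i hi
        rw [Set.mem_preimage, mem_ball_zpow_iff] at hb hb'
        refine (cantorPoint_mem_ball_iff b b' n).1 ?_ i (by simpa using hi)
        rw [mem_ball_zpow_iff]
        exact fun m hm => (hb m hm).trans (hb' m hm).symm
      · rw [coinMeasure_pi_singleton, Finset.card_range]

lemma coinMeasure_le_hgamma (E : Set (ℕ → Bool)) :
    coinMeasure E ≤ hgamma (cantorPoint '' E) := by
  rw [hgamma, hmeas]
  refine le_iSup₂_of_le 1 one_pos ?_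
  refine le_iInf fun S => le_iInf fun hS => le_iInf fun _ => le_iInf fun hcov => ?_
  calc coinMeasure E
      ≤ coinMeasure (⋃ p ∈ S, cantorPoint ⁻¹' ball p.1 ((3 : ℝ) ^ p.2)) := by
        refine MeasureTheory.measure_mono fun b hb => ?_
        simpa using hcov (Set.mem_image_of_mem _ hb)
    _ ≤ ∑' p : S, coinMeasure
          (cantorPoint ⁻¹' ball (p : L3 × ℤ).1 ((3 : ℝ) ^ (p : L3 × ℤ).2)) :=
        MeasureTheory.measure_biUnion_le _ hS _
    _ ≤ _ := ENNReal.tsum_le_tsum fun p => coinMeasure_preimage_ball_le _ _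

/-- Extension of a finite word by `false`. -/
def extendWord {n : ℕ} (w : Fin n → Bool) (i : ℕ) : Bool :=
  if h : i < n then w ⟨i, h⟩ else false

lemma hgamma_le_coinMeasure {E : Set (ℕ → Bool)} {R : ℕ}
    (hE : ∀ b b' : ℕ → Bool, (∀ i < R, b i = b' i) → b ∈ E → b' ∈ E) :
    hgamma (cantorPoint '' E) ≤ coinMeasure E := by
  rw [hgamma, hmeas]
  refine iSup₂_le fun ρ hρ => ?_
  obtain ⟨N, hN⟩ := exists_pow_lt_of_lt_one hρ (show (3⁻¹ : ℝ) < 1 by norm_num)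
  set n := max N R
  have hn : (3 : ℝ) ^ (-(n : ℤ)) ≤ ρ := by
    rw [zpow_neg, zpow_natCast, ← inv_pow]
    exact (pow_le_pow_of_le_one (by norm_num) (by norm_num) (le_max_left N R)).trans hN.le
  let W : Finset (Fin n → Bool) := Finset.univ.filter fun w => extendWord w ∈ E
  let c : (Fin n → Bool) → L3 × ℤ := fun w => (cantorPoint (extendWord w), -(n : ℤ))
  refine iInf₂_le_of_le (↑(W.image c)) (Finset.countable_toSet _) ?_
  refine iInf₂_le_of_le ?_ ?_ ?_
  · intro p hp
    obtain ⟨w, -, rfl⟩ := Finset.mem_image.1 (Finset.mem_coe.1 hp)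
    exact hn
  · rintro _ ⟨b, hb, rfl⟩
    have hbw : ∀ i < n, b i = extendWord (fun j : Fin n => b j) i := fun i hi => by
      simp [extendWord, hi]
    refine Set.mem_biUnion (x := c fun j : Fin n => b j) ?_
      ((cantorPoint_mem_ball_iff _ _ n).2 hbw)
    refine Finset.mem_coe.2 (Finset.mem_image_of_mem c
      (Finset.mem_filter.2 ⟨Finset.mem_univ _, ?_⟩))
    exact hE b _ (fun i hi => hbw i (hi.trans_le (le_max_right N R))) hb
  · let cyl : (Fin n → Bool) → Set (ℕ → Bool) := fun w =>
      Set.pi (Finset.range n) fun i => {extendWord w i}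
    calc _ = ∑ p ∈ W.image c, ENNReal.ofReal (((3 : ℝ) ^ p.2) ^ gam) :=
          Finset.tsum_subtype (W.image c) fun p => ENNReal.ofReal (((3 : ℝ) ^ p.2) ^ gam)
      _ ≤ ∑ w ∈ W, ENNReal.ofReal (((3 : ℝ) ^ (c w).2) ^ gam) :=
          Finset.sum_image_le_of_nonneg fun _ _ => zero_le
      _ = ∑ w ∈ W, coinMeasure (cyl w) := by
          refine Finset.sum_congr rfl fun w _ => ?_
          rw [coinMeasure_pi_singleton, zpow_rpow_gam, ofReal_two_zpow_neg, Finset.card_range]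
      _ = coinMeasure (⋃ w ∈ W, cyl w) := by
          refine (MeasureTheory.measure_biUnion_finset ?_ fun w _ => ?_).symm
          · intro w _ w' _ hne
            refine Set.disjoint_left.2 fun b hb hb' => hne ?_
            funext i
            have h := (hb i (by simp)).symm.trans (hb' i (by simp))
            simpa [extendWord] using h
          · exact MeasurableSet.pi (Finset.countable_toSet _) fun i _ => MeasurableSet.singleton _
      _ ≤ coinMeasure E := by
          refine MeasureTheory.measure_mono (Set.iUnion₂_subset fun w hw b hb => ?_)
          refine hE _ b (fun i hi => ?_) (Finset.mem_filter.1 hw).2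
          exact (hb i (Finset.mem_coe.2 (Finset.mem_range.2 (hi.trans_le (le_max_right N R))))).symm

/-- Prescribing the digits at the positions in `s` leaves a set of `γ`-measure `2 ^ (-#s)`. -/
lemma hgamma_image_pi_singleton (s : Finset ℕ) (c : ℕ → Bool) :
    hgamma (cantorPoint '' Set.pi s fun i => {c i}) = 2⁻¹ ^ s.card := by
  rw [← coinMeasure_pi_singleton s c]
  refine le_antisymm (hgamma_le_coinMeasure (R := s.sup id + 1) ?_) (coinMeasure_le_hgamma _)
  intro b b' h hb i hi
  have := hb i hi
  rwa [h i (Nat.lt_succ_of_le (Finset.le_sup (f := id) hi))] at this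

lemma coeff_toL (g : Polynomial F3) (m : ℤ) :
    (toL g).coeff m = if m ≤ 0 then g.coeff (-m).toNat else 0 := by
  induction g using Polynomial.induction_on' with
  | add p q hp hq =>
    rw [toL, map_add, HahnSeries.coeff_add]
    rw [toL] at hp hq
    rw [hp, hq]
    split_ifs <;> simp
  | monomial k a =>
    rw [toL, Polynomial.aeval_monomial, XL, HahnSeries.single_pow,
      Subsingleton.elim (algebraMap F3 L3) HahnSeries.C, HahnSeries.C_apply,
      HahnSeries.single_mul_single]
    simp only [one_pow, mul_one, zero_add, HahnSeries.coeff_single, Polynomial.coeff_monomial,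
      nsmul_eq_mul]
    split_ifs <;> first | rfl | omega

lemma coeff_toL_div_XL_pow (g : Polynomial F3) (n : ℕ) (m : ℤ) :
    (toL g / XL ^ n).coeff m = if m ≤ n then g.coeff (n - m).toNat else 0 := by
  rw [XL, HahnSeries.single_pow, div_eq_mul_inv, HahnSeries.inv_single, HahnSeries.coeff_mul_single,
    coeff_toL]
  simp [neg_sub]

lemma cantorPoint_mem_Astar_iff {ψ : ℕ → ℝ} {n r : ℕ} (hn : 1 ≤ n) (hnr : n ≤ r)
    (hr : ψ n = (3 : ℝ) ^ (-(r : ℤ))) (b : ℕ → Bool) :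
    cantorPoint b ∈ Astar ψ n ↔ b (n - 1) = true ∧ ∀ i, n ≤ i → i < r → b i = false := by
  simp only [Astar, Set.mem_iUnion, exists_prop, hr, mem_ball_zpow_iff, coeff_toL_div_XL_pow,
    neg_neg]
  constructor
  · rintro ⟨g, ⟨-, -, hg0⟩, hg⟩
    constructor
    · have h := hg n (by omega)
      rw [if_pos le_rfl, sub_self, Int.toNat_zero, hg0, coeff_cantorPoint, if_pos (by omega),
        show ((n : ℤ) - 1).toNat = n - 1 by omega] at h
      by_contra hb
      rw [if_neg hb] at h
      exact two_ne_zero_F3 h.symm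
    · intro i hni hir
      have h := hg (i + 1) (by omega)
      rw [if_neg (by omega), coeff_cantorPoint_succ] at h
      by_contra hb
      rw [if_pos (by simpa using hb)] at h
      exact two_ne_zero_F3 h
  · rintro ⟨h1, h0⟩
    let g : Polynomial F3 := ∑ k ∈ Finset.range n,
      Polynomial.monomial k (if b (n - 1 - k) then (2 : F3) else 0)
    have hg : ∀ k, g.coeff k = if k < n then (if b (n - 1 - k) then (2 : F3) else 0) else 0 := by
      intro k
      simp [g, Polynomial.coeff_monomial]
    refine ⟨g, ⟨?_, ?_, ?_⟩, ?_⟩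
    · rw [Polynomial.degree_lt_iff_coeff_zero]
      intro k hk
      rw [hg, if_neg (by omega)]
    · intro k hk
      rw [hg, if_pos hk]
      split_ifs <;> simp
    · rw [hg, if_pos (by omega), Nat.sub_zero, if_pos h1]
    · intro m hm
      rw [coeff_cantorPoint, hg]
      by_cases hm1 : 1 ≤ m
      · rw [if_pos hm1]
        by_cases hmn : m ≤ n
        · rw [if_pos hmn, if_pos (show ((n : ℤ) - m).toNat < n by omega),
            show n - 1 - ((n : ℤ) - m).toNat = (m - 1).toNat by omega]
        · rw [if_neg hmn, h0 _ (by omega) (by omega)]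
          simp
      · rw [if_neg hm1, if_pos (by omega), if_neg (by omega)]

lemma ball_inter_Astar_inter_Cantor {ψ : ℕ → ℝ} {x : L3} {b₀ : ℕ → Bool} {l n r : ℕ}
    (hx : cantorPoint b₀ ∈ ball x ((3 : ℝ) ^ (-(l : ℤ)))) (hln : l < n) (hnr : n ≤ r)
    (hr : ψ n = (3 : ℝ) ^ (-(r : ℤ))) :
    ball x ((3 : ℝ) ^ (-(l : ℤ))) ∩ Astar ψ n ∩ Cantor =
      cantorPoint '' Set.pi ↑(Finset.range l ∪ Finset.Ico (n - 1) r)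
        fun i => {if i < l then b₀ i else decide (i = n - 1)} := by
  have hball : ∀ b, cantorPoint b ∈ ball x ((3 : ℝ) ^ (-(l : ℤ))) ↔ ∀ i < l, b i = b₀ i := by
    intro b
    rw [← cantorPoint_mem_ball_iff]
    rw [mem_ball_zpow_iff] at hx
    simp only [mem_ball_zpow_iff]
    exact forall₂_congr fun m hm => by rw [hx m hm]
  have hmem : ∀ b, (b ∈ Set.pi (↑(Finset.range l ∪ Finset.Ico (n - 1) r) : Set ℕ)
        fun i => {if i < l then b₀ i else decide (i = n - 1)}) ↔
      cantorPoint b ∈ ball x ((3 : ℝ) ^ (-(l : ℤ))) ∩ Astar ψ n := by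
    intro b
    rw [Set.mem_inter_iff, hball, cantorPoint_mem_Astar_iff (by omega) hnr hr]
    simp only [Set.mem_pi, Finset.coe_union, Finset.coe_range, Finset.coe_Ico, Set.mem_union,
      Set.mem_Iio, Set.mem_Ico, Set.mem_singleton_iff]
    constructor
    · intro h
      refine ⟨fun i hi => ?_, ?_, fun i hni hir => ?_⟩
      · rw [h i (Or.inl hi), if_pos hi]
      · rw [h (n - 1) (Or.inr ⟨le_rfl, by omega⟩), if_neg (by omega), decide_eq_true rfl]
      · rw [h i (Or.inr ⟨by omega, hir⟩), if_neg (by omega), decide_eq_false (by omega)]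
    · rintro ⟨hl, h1, h0⟩ i hi
      split_ifs with hil
      · exact hl i hil
      · by_cases hin : i = n - 1
        · rw [hin, h1, decide_eq_true rfl]
        · rw [decide_eq_false hin]
          exact h0 i (by omega) (by omega)
  ext f
  rw [← range_cantorPoint]
  constructor
  · rintro ⟨hf, b, rfl⟩
    exact ⟨b, (hmem b).2 hf, rfl⟩
  · rintro ⟨b, hb, rfl⟩
    exact ⟨(hmem b).1 hb, b, rfl⟩

/-- Assume `ψ(3^n) ≤ 3^{-n}` for all `n`.  If `B` is a ball with radius
`r(B) = 3^{-ℓ} ≤ 1`, `B ∩ 𝒞 ≠ ∅` and `n > ℓ`, then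
`μ(B ∩ A*_n) = r(B)^γ · (ψ(3ⁿ)·3ⁿ)^γ · 3^{-γ}`; in particular
`μ(A*_n) = (ψ(3ⁿ)·3ⁿ)^γ · 3^{-γ}` for all `n ∈ ℕ`. -/
theorem mu_ball_inter_Astar (ψ : ℕ → ℝ)
    (hψ : ∀ n : ℕ, 1 ≤ n → ∃ r : ℤ, ψ n = (3 : ℝ) ^ (-r))
    (hle : ∀ n : ℕ, 1 ≤ n → ψ n ≤ (3 : ℝ) ^ (-(n : ℤ))) :
    (∀ (x : L3) (ℓ : ℕ), (ball x ((3 : ℝ) ^ (-(ℓ : ℤ))) ∩ Cantor).Nonempty →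
      ∀ n : ℕ, ℓ < n →
        mu (ball x ((3 : ℝ) ^ (-(ℓ : ℤ))) ∩ Astar ψ n)
          = ENNReal.ofReal
              (((3 : ℝ) ^ (-(ℓ : ℤ))) ^ gam * (ψ n * (3 : ℝ) ^ n) ^ gam * (3 : ℝ) ^ (-gam)))
    ∧ ∀ n : ℕ, 1 ≤ n →
        mu (Astar ψ n)
          = ENNReal.ofReal ((ψ n * (3 : ℝ) ^ n) ^ gam * (3 : ℝ) ^ (-gam)) := by

  have main : ∀ (x : L3) (ℓ : ℕ), (ball x ((3 : ℝ) ^ (-(ℓ : ℤ))) ∩ Cantor).Nonempty →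
      ∀ n : ℕ, ℓ < n →
        mu (ball x ((3 : ℝ) ^ (-(ℓ : ℤ))) ∩ Astar ψ n)
          = ENNReal.ofReal
              (((3 : ℝ) ^ (-(ℓ : ℤ))) ^ gam * (ψ n * (3 : ℝ) ^ n) ^ gam * (3 : ℝ) ^ (-gam)) := by
    rintro x ℓ ⟨f, hfx, hfC⟩ n hn
    rw [← range_cantorPoint] at hfC
    obtain ⟨b₀, rfl⟩ := hfC
    obtain ⟨r', hr'⟩ := hψ n (by omega)
    have hnr' : (n : ℤ) ≤ r' := by
      have h := hle n (by omega)
      rw [hr', zpow_le_zpow_iff_right₀ (by norm_num)] at h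
      omega
    obtain ⟨r, rfl⟩ := Int.eq_ofNat_of_zero_le (show 0 ≤ r' by omega)
    have hcard : (Finset.range ℓ ∪ Finset.Ico (n - 1) r).card = ℓ + (r - (n - 1)) := by
      rw [Finset.card_union_of_disjoint, Finset.card_range, Nat.card_Ico]
      rw [Finset.disjoint_left]
      intro i hi hi'
      rw [Finset.mem_range] at hi
      rw [Finset.mem_Ico] at hi'
      omega
    rw [mu, ball_inter_Astar_inter_Cantor hfx hn (by omega) hr', hgamma_image_pi_singleton, hcard,
      ← ofReal_two_zpow_neg, hr', Real.rpow_neg (by norm_num), ← zpow_natCast (3 : ℝ) n,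
      ← zpow_add₀ (by norm_num), zpow_rpow_gam, zpow_rpow_gam]
    have h3 : (3 : ℝ) ^ gam = 2 := by simpa using zpow_rpow_gam 1
    rw [h3, ← zpow_neg_one, ← zpow_add₀ (by norm_num), ← zpow_add₀ (by norm_num)]
    congr 2
    omega
  refine ⟨main, fun n hn => ?_⟩
  have h0 : Cantor ⊆ ball 0 ((3 : ℝ) ^ (-((0 : ℕ) : ℤ))) := fun f hf => by
    rw [mem_ball_zpow_iff]
    intro m hm
    rw [hf.1 m (by simpa using hm), HahnSeries.coeff_zero]
  have hne : (ball 0 ((3 : ℝ) ^ (-((0 : ℕ) : ℤ))) ∩ Cantor).Nonempty := by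
    rw [Set.inter_eq_right.2 h0, ← range_cantorPoint]
    exact Set.range_nonempty _
  have h := main 0 0 hne n hn
  rw [mu, Set.inter_assoc, Set.inter_eq_right.2 (Set.inter_subset_right.trans h0)] at h
  simpa [mu] using h
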